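/- Let n = 2m and let F : F_{2^n} → F_{2^n} satisfy F(x^2) = F(x)^2 for all x and #S_F = 2^m, assume ℓ(n) > m, and assume moreover that F is plateaued. Then 𝒩_F ≤ 2^{n−1} − 2^{⌊3n/4⌋}. -/

import Mathlib

open Finset

/-- The Walsh transform `W_{F_a}(ω) = Σ_v (−1)^{Tr(a·F(v)) + Tr(ω·v)}`. -/
noncomputable def walsh {K : Type*} [Field K] [Fintype K] [Algebra (ZMod 2) K]
    (F : K → K) (a ω : K) : ℤ :=
  ∑ v : K, if Algebra.trace (ZMod 2) K (a * F v) + Algebra.trace (ZMod 2) K (ω * v) = 0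
    then 1 else -1

/-- The component `F_a` is bent: all Walsh values are `±2^m`. -/
def IsBent {K : Type*} [Field K] [Fintype K] [Algebra (ZMod 2) K]
    (m : ℕ) (F : K → K) (a : K) : Prop :=
  ∀ ω : K, walsh F a ω = 2 ^ m ∨ walsh F a ω = -(2 ^ m)

/-- The `F₂`-span of the Frobenius orbit `{γ, γ², γ⁴, …}` of `γ`. -/
def frobSpan (K : Type*) [Field K] [Algebra (ZMod 2) K] (γ : K) : Submodule (ZMod 2) K :=
  Submodule.span (ZMod 2) (Set.range fun i : ℕ => γ ^ (2 ^ i))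

/-- The nonlinearity `𝒩_F = 2^{n−1} − (1/2)·max{|W_{F_a}(ω)| : a ≠ 0, ω}`. -/
noncomputable def nonlinearity {K : Type*} [Field K] [Fintype K] [Algebra (ZMod 2) K]
    (n : ℕ) (F : K → K) : ℝ :=
  2 ^ (n - 1) - (1 / 2) *
    (⨆ a : {a : K // a ≠ 0}, ⨆ ω : K, (|walsh F (a : K) ω| : ℝ))

/-- `F` is plateaued: every nonzero component has Walsh values in `{0, ±2^j}` for some `j`. -/
def IsPlateaued {K : Type*} [Field K] [Fintype K] [Algebra (ZMod 2) K] (F : K → K) : Prop :=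
  ∀ a : K, a ≠ 0 → ∃ j : ℕ, ∀ ω : K,
    walsh F a ω = 0 ∨ walsh F a ω = 2 ^ j ∨ walsh F a ω = -(2 ^ j)

section Walsh

theorem add_eq_zero_iff_eq_of_zmod_two {K : Type*} [Field K] [Algebra (ZMod 2) K] (x y : K) :
    x + y = 0 ↔ y = x := by
  have : CharP K 2 := charP_of_injective_algebraMap (algebraMap (ZMod 2) K).injective 2
  rw [CharTwo.add_eq_zero, eq_comm]

variable {K : Type*} [Field K] [Fintype K] [Algebra (ZMod 2) K]

/-- The canonical additive character `x ↦ (−1)^{Tr x}`. -/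
noncomputable def traceSign (K : Type*) [Field K] [Fintype K] [Algebra (ZMod 2) K] :
    AddChar K ℤ where
  toFun x := if Algebra.trace (ZMod 2) K x = 0 then 1 else -1
  map_zero_eq_one' := by simp
  map_add_eq_mul' x y := by
    rw [map_add]
    generalize Algebra.trace (ZMod 2) K x = s
    generalize Algebra.trace (ZMod 2) K y = t
    revert s t
    decide

theorem walsh_eq_sum_traceSign (F : K → K) (a ω : K) :
    walsh F a ω = ∑ v, traceSign K (a * F v + ω * v) := by
  simp only [walsh, traceSign, AddChar.coe_mk, map_add]

theorem traceSign_isPrimitive : (traceSign K).IsPrimitive := by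
  apply AddChar.IsPrimitive.of_ne_one
  intro h
  obtain ⟨x, hx⟩ := Algebra.trace_surjective (ZMod 2) K 1
  have := DFunLike.congr_fun h x
  simp [traceSign, hx] at this

theorem sum_traceSign_mul [DecidableEq K] (b : K) :
    ∑ x, traceSign K (x * b) = if b = 0 then (Fintype.card K : ℤ) else 0 := by
  simpa using AddChar.sum_mulShift b (traceSign_isPrimitive (K := K))

/-- Parseval's identity. -/
theorem sum_walsh_sq (F : K → K) (a : K) :
    ∑ ω, walsh F a ω ^ 2 = (Fintype.card K : ℤ) ^ 2 := by
  classical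
  calc ∑ ω, walsh F a ω ^ 2
      = ∑ ω, ∑ x, ∑ y, traceSign K (a * (F x + F y)) * traceSign K (ω * (x + y)) := by
        refine sum_congr rfl fun ω _ => ?_
        rw [walsh_eq_sum_traceSign, sq, sum_mul_sum]
        refine sum_congr rfl fun x _ => sum_congr rfl fun y _ => ?_
        rw [← AddChar.map_add_eq_mul, ← AddChar.map_add_eq_mul]
        congr 1; ring
    _ = ∑ x, ∑ y, traceSign K (a * (F x + F y)) * ∑ ω, traceSign K (ω * (x + y)) := by
        rw [sum_comm]
        refine sum_congr rfl fun x _ => ?_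
        rw [sum_comm]
        simp only [mul_sum]
    _ = (Fintype.card K : ℤ) ^ 2 := by
        have h (x : K) : traceSign K (a * (F x + F x)) = 1 := by
          rw [(add_eq_zero_iff_eq_of_zmod_two (F x) (F x)).2 rfl, mul_zero,
            AddChar.map_zero_eq_one]
        simp [sum_traceSign_mul, add_eq_zero_iff_eq_of_zmod_two, h, sq]

/-- The total fourth moment of the Walsh transform counts the vanishing sums
`F x + F y + F z + F (x + y + z)`. -/
theorem sum_walsh_pow_four [DecidableEq K] (F : K → K) :
    ∑ a, ∑ ω, walsh F a ω ^ 4 = (Fintype.card K : ℤ) ^ 2 *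
      ∑ x, ∑ y, ∑ z, if F x + F y + F z + F (x + y + z) = 0 then (1 : ℤ) else 0 := by
  have expand (a ω : K) : walsh F a ω ^ 4 = ∑ x, ∑ y, ∑ z, ∑ w,
      traceSign K (a * (F x + F y + F z + F w)) * traceSign K (ω * (x + y + z + w)) := by
    rw [walsh_eq_sum_traceSign, show ∀ s : ℤ, s ^ 4 = s * (s * (s * s)) by intro s; ring]
    simp only [sum_mul, mul_sum]
    refine sum_congr rfl fun x _ => sum_congr rfl fun y _ => sum_congr rfl fun z _ =>
      sum_congr rfl fun w _ => ?_
    simp only [← AddChar.map_add_eq_mul]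
    congr 1; ring
  have swap (f : K → K → K → K → K → ℤ) : ∑ a, ∑ x, ∑ y, ∑ z, ∑ w, f a x y z w =
      ∑ x, ∑ y, ∑ z, ∑ w, ∑ a, f a x y z w := by
    rw [sum_comm]
    refine sum_congr rfl fun x _ => ?_
    rw [sum_comm]
    refine sum_congr rfl fun y _ => ?_
    rw [sum_comm]
    refine sum_congr rfl fun z _ => ?_
    rw [sum_comm]
  simp only [expand, swap, ← mul_sum, ← sum_mul, sum_traceSign_mul]
  simp only [add_eq_zero_iff_eq_of_zmod_two, mul_ite, ite_mul, zero_mul, mul_zero, sum_ite_eq',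
    mem_univ, if_true, mul_sum, mul_one, sq]

theorem le_sum_walsh_pow_four (F : K → K) :
    (Fintype.card K : ℤ) ^ 2 * (3 * (Fintype.card K : ℤ) ^ 2 - 2 * Fintype.card K) ≤
      ∑ a, ∑ ω, walsh F a ω ^ 4 := by
  classical
  rw [sum_walsh_pow_four]
  refine mul_le_mul_of_nonneg_left ?_ (by positivity)
  have : CharP K 2 := charP_of_injective_algebraMap (algebraMap (ZMod 2) K).injective 2
  calc 3 * (Fintype.card K : ℤ) ^ 2 - 2 * Fintype.card K
      = ∑ x : K, ∑ y : K, ∑ z : K, ((if x = y then 1 else 0) + (if y = z then 1 else 0) +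
          (if x = z then 1 else 0) - 2 * (if x = y then (if y = z then 1 else 0) else 0)) := by
        simp [sum_add_distrib, sum_sub_distrib]
        ring
    _ ≤ _ := by
        refine sum_le_sum fun x _ => sum_le_sum fun y _ => sum_le_sum fun z _ => ?_
        have hxy : x = y → F x + F y + F z + F (x + y + z) = 0 := by
          rintro rfl
          simp [CharTwo.add_self_eq_zero]
        have hyz : y = z → F x + F y + F z + F (x + y + z) = 0 := by
          rintro rfl
          simp [add_assoc, CharTwo.add_self_eq_zero]
        have hxz : x = z → F x + F y + F z + F (x + y + z) = 0 := by
          rintro rfl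
          rw [show x + y + x = y + (x + x) by ring, CharTwo.add_self_eq_zero, add_zero,
            show F x + F y + F x + F y = (F x + F x) + (F y + F y) by ring,
            CharTwo.add_self_eq_zero, CharTwo.add_self_eq_zero, add_zero]
        split_ifs <;> simp_all

theorem walsh_zero_zero (F : K → K) : walsh F 0 0 = Fintype.card K := by
  simp [walsh]

theorem sum_walsh_zero_pow_four (F : K → K) :
    ∑ ω, walsh F 0 ω ^ 4 = (Fintype.card K : ℤ) ^ 4 := by
  classical
  have h (ω : K) : walsh F 0 ω = if ω = 0 then (Fintype.card K : ℤ) else 0 := by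
    rw [walsh_eq_sum_traceSign, ← sum_traceSign_mul]
    exact sum_congr rfl fun v _ => by rw [zero_mul, zero_add, mul_comm]
  simp [h]

theorem not_isBent_zero {m : ℕ} (hm : 0 < m) (hcard : Fintype.card K = 2 ^ (2 * m))
    (F : K → K) : ¬ IsBent m F 0 := by
  intro h
  have hlt : (2 : ℤ) ^ m < 2 ^ (2 * m) := pow_lt_pow_right₀ (by norm_num) (by lia)
  have hpos : (0 : ℤ) < 2 ^ m := by positivity
  have h0 := h 0
  rw [walsh_zero_zero, hcard] at h0
  push_cast at h0
  lia

theorem IsBent.sum_walsh_pow_four {m : ℕ} (hcard : Fintype.card K = 2 ^ (2 * m)) {F : K → K}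
    {a : K} (h : IsBent m F a) : ∑ ω, walsh F a ω ^ 4 = (2 ^ m : ℤ) ^ 6 := by
  have hW (ω : K) : walsh F a ω ^ 4 = (2 ^ m : ℤ) ^ 4 := by
    rcases h ω with h | h <;> rw [h]
    ring
  simp only [hW, sum_const, card_univ, hcard, nsmul_eq_mul]
  push_cast
  ring

theorem sum_walsh_pow_four_le {F : K → K} {a : K} {B : ℤ} (hB : ∀ ω, |walsh F a ω| ≤ B) :
    ∑ ω, walsh F a ω ^ 4 ≤ B ^ 2 * (Fintype.card K : ℤ) ^ 2 := by
  rw [← sum_walsh_sq F a, mul_sum]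
  refine sum_le_sum fun ω _ => ?_
  rw [show walsh F a ω ^ 4 = walsh F a ω ^ 2 * walsh F a ω ^ 2 by ring]
  exact mul_le_mul_of_nonneg_right (sq_le_sq.2 ((hB ω).trans (le_abs_self B))) (sq_nonneg _)

/-- If `n = 2m` and exactly `2^m` components are not bent, then the Walsh values of the nonzero
components cannot all be bounded by `2^t` with `2t ≤ 3m`. -/
theorem exists_pow_lt_abs_walsh {m t : ℕ} (hm : 0 < m) (ht : 2 * t ≤ 3 * m)
    (hcard : Fintype.card K = 2 ^ (2 * m)) (F : K → K)
    (hSF : Set.ncard {a : K | ¬ IsBent m F a} = 2 ^ m) :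
    ∃ a : K, a ≠ 0 ∧ ∃ ω, 2 ^ t < |walsh F a ω| := by
  classical
  by_contra! hB
  set q : ℤ := 2 ^ m with hq
  have hq1 : 1 < q := one_lt_pow₀ (by norm_num) hm.ne'
  have hQ : (Fintype.card K : ℤ) = q ^ 2 := by rw [hcard]; push_cast; ring
  have hS : (#{a : K | ¬ IsBent m F a} : ℤ) = q := by
    rw [Set.ncard_eq_toFinset_card', Set.toFinset_ofPred] at hSF
    rw [hSF]
    simp [hq]
  have hT : (#{a : K | IsBent m F a} : ℤ) = q ^ 2 - q := by
    have := card_filter_add_card_filter_not (s := (univ : Finset K)) (IsBent m F)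
    rw [card_univ] at this
    linarith [congrArg (Nat.cast (R := ℤ)) this, Nat.cast_add (R := ℤ)
      #{a : K | IsBent m F a} #{a : K | ¬ IsBent m F a}]
  have h0 : (0 : K) ∈ ({a : K | ¬ IsBent m F a} : Finset K) := by
    simpa using not_isBent_zero hm hcard F
  have hbent : ∑ a with IsBent m F a, ∑ ω, walsh F a ω ^ 4 = (q ^ 2 - q) * q ^ 6 := by
    rw [sum_congr rfl fun a ha => (mem_filter.1 ha).2.sum_walsh_pow_four hcard, sum_const,
      nsmul_eq_mul, hT]
  have hnot : ∑ a with ¬ IsBent m F a, ∑ ω, walsh F a ω ^ 4 ≤ q ^ 8 + (q - 1) * q ^ 7 := by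
    rw [← add_sum_erase _ _ h0, sum_walsh_zero_pow_four, hQ]
    have hle : ∀ a ∈ ({a : K | ¬ IsBent m F a} : Finset K).erase 0,
        ∑ ω, walsh F a ω ^ 4 ≤ q ^ 7 := by
      intro a ha
      refine (sum_walsh_pow_four_le (hB a (ne_of_mem_erase ha))).trans ?_
      have : ((2 : ℤ) ^ t) ^ 2 ≤ q ^ 3 := by
        rw [hq, ← pow_mul, ← pow_mul]
        exact pow_le_pow_right₀ (by norm_num) (by lia)
      rw [hQ]
      nlinarith [pow_pos (zero_lt_one.trans hq1) 4]
    have := sum_le_card_nsmul _ _ _ hle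
    rw [nsmul_eq_mul, card_erase_of_mem h0, Nat.cast_sub (card_pos.2 ⟨0, h0⟩), hS] at this
    push_cast at this
    linarith [show (q ^ 2) ^ 4 = q ^ 8 by ring]
  have htotal := le_sum_walsh_pow_four F
  rw [← sum_filter_add_sum_filter_not univ (IsBent m F), hbent, hQ] at htotal
  have : 0 < q ^ 6 * (q - 1) := mul_pos (by positivity) (by linarith)
  nlinarith

end Walsh

/-- Let `n = 2m`, `F : F_{2^n} → F_{2^n}` commute with the Frobenius, `#S_F = 2^m`,
`ℓ(n) > m`, and suppose `F` is plateaued.  Then `𝒩_F ≤ 2^{n−1} − 2^{⌊3n/4⌋}`. -/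
theorem stmt15 (m n : ℕ) (hm : 0 < m) (hn : n = 2 * m)
    (K : Type*) [Field K] [Fintype K] [Algebra (ZMod 2) K]
    (hcard : Fintype.card K = 2 ^ n)
    (F : K → K) (hcomm : ∀ x, F (x ^ 2) = (F x) ^ 2)
    (hSF : Set.ncard {a : K | ¬ IsBent m F a} = 2 ^ m)
    (hell : ∀ γ : K, Subfield.closure {γ} = ⊤ →
      m < Module.finrank (ZMod 2) (frobSpan K γ))
    (hplat : IsPlateaued F) :
    nonlinearity n F ≤ 2 ^ (n - 1) - 2 ^ ((3 * n) / 4) := by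
  subst hn
  obtain ⟨a, ha, ω, hω⟩ :=
    exists_pow_lt_abs_walsh (t := 3 * (2 * m) / 4) hm (by lia) hcard F hSF
  have hstep : (2 : ℤ) ^ (3 * (2 * m) / 4 + 1) ≤ |walsh F a ω| := by
    obtain ⟨j, hj⟩ := hplat a ha
    have habs : |walsh F a ω| = 2 ^ j := by
      rcases hj ω with h | h | h
      · rw [h, abs_zero] at hω
        exact absurd hω (not_lt.2 (by positivity))
      · rw [h, abs_of_pos (by positivity)]
      · rw [h, abs_neg, abs_of_pos (by positivity)]
    rw [habs] at hω ⊢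
    exact pow_le_pow_right₀ (by norm_num) ((pow_lt_pow_iff_right₀ (by norm_num)).1 hω)
  have hsup : ((2 : ℝ) ^ (3 * (2 * m) / 4 + 1)) ≤
      ⨆ a : {a : K // a ≠ 0}, ⨆ ω : K, (|walsh F (a : K) ω| : ℝ) := by
    refine le_trans ?_ (le_ciSup (Set.finite_range _).bddAbove (⟨a, ha⟩ : {a : K // a ≠ 0}))
    refine le_trans ?_ (le_ciSup (Set.finite_range _).bddAbove ω)
    exact_mod_cast hstep
  rw [pow_succ] at hsup
  unfold nonlinearity
  linarith
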